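/- arXiv:1505.03373 — 2 statements merged into one kernel-verified Lean document; each statement's English description precedes it below -/
import Mathlib

section
/- Let H be the Hermitian adjacency matrix of a mixed graph on a vertex type with exactly 3 elements v₀, v₁, v₂, and suppose the underlying graph G(H) is connected. Write a = H v₀ v₁, b = H v₁ v₂, c = H v₀ v₂. Then Matrix.rank H = 2 if and only if either exactly one of a, b, c equals 0 (the underlying graph is a path), or all of a, b, c are nonzero and an odd number of the three entries a, b, c lies in {I, -I} (the mixed graph is an odd triangle, i.e. a triangle with an odd number of arcs). -/
open Complex

/-- `H` is the Hermitian adjacency matrix of a mixed graph: Hermitian, zero diagonal,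
entries in `{0, 1, I, -I}`. -/
def IsHermAdj {V : Type*} [Fintype V] (H : Matrix V V ℂ) : Prop :=
  H.IsHermitian ∧ (∀ v, H v v = 0) ∧
    ∀ u v, H u v ∈ ({0, 1, Complex.I, -Complex.I} : Set ℂ)

namespace Matrix

theorem rank_eq_card_iff_det_ne_zero {K n : Type*} [Field K] [Fintype n] [DecidableEq n]
    (A : Matrix n n K) : A.rank = Fintype.card n ↔ A.det ≠ 0 := by
  refine ⟨fun h => ?_, fun h => rank_of_det_ne_zero h⟩
  have hli : LinearIndependent K A.col := by
    rw [linearIndependent_iff_card_eq_finrank_span, Set.finrank, ← rank_eq_finrank_span_cols, h]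
  exact ((isUnit_iff_isUnit_det A).1 (linearIndependent_cols_iff_isUnit.1 hli)).ne_zero

end Matrix

theorem IsHermAdj.two_le_rank {V : Type*} [Fintype V] {H : Matrix V V ℂ}
    (hH : IsHermAdj H) {u v : V} (huv : H u v ≠ 0) : 2 ≤ H.rank := by
  have hdet : (H.submatrix ![u, v] ![u, v]).det ≠ 0 := by
    have hvu : H v u ≠ 0 := by
      rw [← hH.1.apply]
      simpa using huv
    rw [Matrix.det_fin_two]
    simp [hH.2.1, huv, hvu]
  calc
    2 = (H.submatrix ![u, v] ![u, v]).rank := by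
      rw [Matrix.rank_of_det_ne_zero hdet, Fintype.card_fin]
    _ ≤ H.rank := H.rank_submatrix_le _ _

theorem IsHermAdj.rank_eq_two_iff {H : Matrix (Fin 3) (Fin 3) ℂ} (hH : IsHermAdj H)
    {u v : Fin 3} (huv : H u v ≠ 0) : H.rank = 2 ↔ H.det = 0 := by
  have h2 := hH.two_le_rank huv
  have h3 : H.rank ≤ 3 := H.rank_le_width
  have hdet := H.rank_eq_card_iff_det_ne_zero
  rw [Fintype.card_fin] at hdet
  rw [← not_iff_not, ← Ne.eq_def H.det, ← hdet]
  omega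

theorem IsHermAdj.det_fin_three {H : Matrix (Fin 3) (Fin 3) ℂ} (hH : IsHermAdj H) :
    H.det = H 0 1 * H 1 2 * star (H 0 2) + star (H 0 1) * star (H 1 2) * H 0 2 := by
  rw [Matrix.det_fin_three, hH.1.apply, hH.1.apply, hH.1.apply]
  simp only [hH.2.1]
  ring

theorem stmt6 (H : Matrix (Fin 3) (Fin 3) ℂ) (hH : IsHermAdj H)
    (G : SimpleGraph (Fin 3)) (hG : ∀ u v, G.Adj u v ↔ u ≠ v ∧ H u v ≠ 0)
    (hconn : G.Connected)
    (a b c : ℂ) (ha : a = H 0 1) (hb : b = H 1 2) (hc : c = H 0 2) :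
    Matrix.rank H = 2 ↔
      ((a = 0 ∧ b ≠ 0 ∧ c ≠ 0) ∨ (a ≠ 0 ∧ b = 0 ∧ c ≠ 0) ∨ (a ≠ 0 ∧ b ≠ 0 ∧ c = 0)) ∨
      (a ≠ 0 ∧ b ≠ 0 ∧ c ≠ 0 ∧
        Odd ((if a = Complex.I ∨ a = -Complex.I then 1 else 0) +
             (if b = Complex.I ∨ b = -Complex.I then 1 else 0) +
             (if c = Complex.I ∨ c = -Complex.I then 1 else 0) : ℕ)) := by
  have nbr (u : Fin 3) : ∃ v, u ≠ v ∧ H u v ≠ 0 := by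
    obtain ⟨v, hv⟩ := hconn.preconnected.exists_adj_of_nontrivial u
    exact ⟨v, (hG u v).1 hv⟩
  have h0 : a ≠ 0 ∨ c ≠ 0 := by
    simpa [Fin.exists_fin_succ, ha, hc] using nbr 0
  have h1 : a ≠ 0 ∨ b ≠ 0 := by
    simpa [Fin.exists_fin_succ, ha, hb, ← hH.1.apply 1 0] using nbr 1
  have h2 : c ≠ 0 ∨ b ≠ 0 := by
    simpa [Fin.exists_fin_succ, hc, hb, ← hH.1.apply 2 0, ← hH.1.apply 2 1] using nbr 2
  have hrank : H.rank = 2 ↔ H.det = 0 := by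
    obtain ⟨v, -, hv⟩ := nbr 0
    exact hH.rank_eq_two_iff hv
  rw [hrank, hH.det_fin_three, ← ha, ← hb, ← hc]
  have ha' := hH.2.2 0 1
  have hb' := hH.2.2 1 2
  have hc' := hH.2.2 0 2
  rw [← ha] at ha'
  rw [← hb] at hb'
  rw [← hc] at hc'
  clear ha hb hc
  simp only [Set.mem_insert_iff, Set.mem_singleton_iff] at ha' hb' hc'
  rcases ha' with rfl | rfl | rfl | rfl <;> rcases hb' with rfl | rfl | rfl | rfl <;>
    rcases hc' with rfl | rfl | rfl | rfl <;>
    simp_all [Nat.odd_iff, Complex.ext_iff]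
end

section
/- Let a and n be integers with 0 < a < n and a² < 2n. Then the Hermitian adjacency matrix of the digraph C₃(n−a, n, n+a) is determined by its Hermitian spectrum if and only if a is not divisible by any prime p with p ≡ 1 (mod 6). -/
open Complex

/-- `M` is determined by its Hermitian spectrum. -/
def IsDHS {V : Type*} [Fintype V] [DecidableEq V] (M : Matrix V V ℂ) : Prop :=
  ∀ H : Matrix V V ℂ, IsHermAdj H → H.charpoly = M.charpoly →
    ∃ σ : Equiv.Perm V, ∃ s : V → ℂ,
      (∀ v, s v ∈ ({1, -1, Complex.I, -Complex.I} : Set ℂ)) ∧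
      ((∀ u v, H u v = s u * (starRingEnd ℂ) (s v) * M (σ u) (σ v)) ∨
       (∀ u v, H u v = s u * (starRingEnd ℂ) (s v) * (starRingEnd ℂ) (M (σ u) (σ v))))

/-- Hermitian adjacency matrix of `C₃(x,y,z)`: the complete tripartite mixed graph with
parts of sizes `x`, `y`, `z` and all arcs directed cyclically. -/
def C3M (x y z : ℕ) : Matrix (Fin x ⊕ Fin y ⊕ Fin z) (Fin x ⊕ Fin y ⊕ Fin z) ℂ :=
  fun u v =>
    match u, v with
    | Sum.inl _, Sum.inr (Sum.inl _) => Complex.I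
    | Sum.inr (Sum.inl _), Sum.inr (Sum.inr _) => Complex.I
    | Sum.inr (Sum.inr _), Sum.inl _ => Complex.I
    | Sum.inr (Sum.inl _), Sum.inl _ => -Complex.I
    | Sum.inr (Sum.inr _), Sum.inr (Sum.inl _) => -Complex.I
    | Sum.inl _, Sum.inr (Sum.inr _) => -Complex.I
    | _, _ => 0

theorem dvd_of_sq_dvd_eisenstein {p : ℕ} (hp : p.Prime) (hp6 : p % 6 ≠ 1) {u v : ℤ}
    (h : (p : ℤ) ^ 2 ∣ u ^ 2 + u * v + v ^ 2) : (p : ℤ) ∣ u ∧ (p : ℤ) ∣ v := by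
  by_cases h3 : p = 3
  · subst h3
    have p3 : Prime (3 : ℤ) := Int.prime_three
    obtain ⟨m, hm⟩ := h
    push_cast at hm ⊢
    have h1 : (3 : ℤ) ∣ (u - v) ^ 2 := ⟨3 * m - u * v, by linear_combination hm⟩
    obtain ⟨k, hk⟩ := p3.dvd_of_dvd_pow h1
    have h2 : (3 : ℤ) ∣ v ^ 2 := by
      have hu : u = v + 3 * k := by linarith
      subst hu
      exact ⟨m - k * v - k ^ 2, by linarith⟩
    obtain ⟨l, hl⟩ := p3.dvd_of_dvd_pow h2
    exact ⟨⟨k + l, by linarith⟩, ⟨l, hl⟩⟩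
  · have : Fact p.Prime := ⟨hp⟩
    have hz : (u : ZMod p) ^ 2 + u * v + (v : ZMod p) ^ 2 = 0 := by
      have : ((u ^ 2 + u * v + v ^ 2 : ℤ) : ZMod p) = 0 :=
        (ZMod.intCast_zmod_eq_zero_iff_dvd _ _).2 ((dvd_pow_self _ two_ne_zero).trans h)
      exact_mod_cast this
    have hv : (v : ZMod p) = 0 := by
      by_contra hv
      set r : ZMod p := u / v with hr
      have hr0 : r ^ 2 + r + 1 = 0 := by
        rw [hr]
        field_simp
        linear_combination hz
      have hr3 : r ^ 3 = 1 := by linear_combination (r - 1) * hr0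
      have hr1 : r ≠ 1 := by
        intro hr1
        rw [hr1] at hr0
        have : ((3 : ℕ) : ZMod p) = 0 := by push_cast; linear_combination hr0
        rw [ZMod.natCast_eq_zero_iff] at this
        exact h3 ((Nat.prime_dvd_prime_iff_eq hp Nat.prime_three).1 this)
      have ho : orderOf r = 3 := orderOf_eq_prime hr3 hr1
      have hd : 3 ∣ p - 1 := by
        rw [← ho]
        apply ZMod.orderOf_dvd_card_sub_one
        intro h0
        simp [h0] at hr0
      have h2 := hp.two_le
      rcases hp.eq_two_or_odd with h | h <;> omega
    have hu : (u : ZMod p) = 0 := by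
      rw [hv] at hz
      simpa using hz
    exact ⟨(ZMod.intCast_zmod_eq_zero_iff_dvd _ _).1 hu,
      (ZMod.intCast_zmod_eq_zero_iff_dvd _ _).1 hv⟩

theorem mul_eq_zero_of_eisenstein_eq_sq (a : ℕ) (ha : 0 < a)
    (hp : ¬ ∃ p : ℕ, p.Prime ∧ p % 6 = 1 ∧ p ∣ a) (u v : ℤ)
    (h : u ^ 2 + u * v + v ^ 2 = (a : ℤ) ^ 2) : u * v * (u + v) = 0 := by
  induction a using Nat.strong_induction_on generalizing u v with
  | _ a ih =>
    by_cases h1 : a = 1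
    · subst h1
      have hv : v ^ 2 ≤ 1 := by push_cast at h; nlinarith [sq_nonneg (2 * u + v)]
      have hu : u ^ 2 ≤ 1 := by push_cast at h; nlinarith [sq_nonneg (2 * v + u)]
      obtain ⟨hv1, hv2⟩ := abs_le.1 ((sq_le_one_iff_abs_le_one v).1 hv)
      obtain ⟨hu1, hu2⟩ := abs_le.1 ((sq_le_one_iff_abs_le_one u).1 hu)
      interval_cases u <;> interval_cases v <;> simp_all
    · obtain ⟨p, pp, b, rfl⟩ := Nat.exists_prime_and_dvd h1
      have hp6 : p % 6 ≠ 1 := fun h6 => hp ⟨p, pp, h6, dvd_mul_right _ _⟩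
      obtain ⟨⟨u', rfl⟩, ⟨v', rfl⟩⟩ := dvd_of_sq_dvd_eisenstein pp hp6
        (u := u) (v := v) ⟨(b : ℤ) ^ 2, by rw [h]; push_cast; ring⟩
      have hb : 0 < b := Nat.pos_of_mul_pos_left ha
      have hp0 : (p : ℤ) ≠ 0 := by exact_mod_cast pp.ne_zero
      have := ih b (by nlinarith [pp.two_le]) hb
        (fun ⟨q, hq, hq6, hqb⟩ => hp ⟨q, hq, hq6, hqb.mul_left _⟩) u' v' (by
          apply mul_left_cancel₀ (pow_ne_zero 2 hp0)
          push_cast at h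
          linear_combination h)
      linear_combination (p : ℤ) ^ 3 * this

theorem exists_eisenstein_eq_prime {p : ℕ} (hp : p.Prime) (hp6 : p % 6 = 1) :
    ∃ x y : ℤ, x ^ 2 + x * y + y ^ 2 = p := by
  have : Fact p.Prime := ⟨hp⟩
  obtain ⟨r, hr⟩ : ∃ r : ZMod p, r ^ 2 + r + 1 = 0 := by
    have : Fact (Nat.Prime 3) := ⟨Nat.prime_three⟩
    obtain ⟨g, hg⟩ := exists_prime_orderOf_dvd_card (G := (ZMod p)ˣ) 3 (by
      rw [ZMod.card_units]; omega)
    have h3 : (g : ZMod p) ^ 3 = 1 := by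
      rw [← Units.val_pow_eq_pow_val, ← hg, pow_orderOf_eq_one, Units.val_one]
    have h1 : (g : ZMod p) - 1 ≠ 0 := by
      intro h
      have : g = 1 := Units.ext (by simpa [sub_eq_zero] using h)
      rw [this, orderOf_one] at hg
      omega
    exact ⟨g, mul_left_cancel₀ h1 (by linear_combination h3)⟩
  set k := Nat.sqrt p
  have hk : k * k < p := by
    refine lt_of_le_of_ne (Nat.sqrt_le p) fun h => ?_
    have := Irreducible.isUnit_or_isUnit hp h.symm
    simp only [Nat.isUnit_iff, or_self] at this
    rw [this] at h
    exact hp.one_lt.ne h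
  obtain ⟨⟨x₁, y₁⟩, h₁, ⟨x₂, y₂⟩, h₂, hne, heq⟩ :=
    Finset.exists_ne_map_eq_of_card_lt_of_maps_to
      (s := Finset.range (k + 1) ×ˢ Finset.range (k + 1)) (t := (Finset.univ : Finset (ZMod p)))
      (f := fun z => (z.1 : ZMod p) - r * z.2)
      (by simpa [ZMod.card] using Nat.lt_succ_sqrt p) (by intro _ _; simp)
  simp only [Finset.mem_product, Finset.mem_range] at h₁ h₂ heq
  obtain ⟨x, hx⟩ : ∃ x : ℤ, x = x₁ - x₂ := ⟨_, rfl⟩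
  obtain ⟨y, hy⟩ : ∃ y : ℤ, y = y₁ - y₂ := ⟨_, rfl⟩
  have hxk : x ^ 2 ≤ (k : ℤ) ^ 2 := sq_le_sq' (by omega) (by omega)
  have hyk : y ^ 2 ≤ (k : ℤ) ^ 2 := sq_le_sq' (by omega) (by omega)
  have hk' : (k : ℤ) ^ 2 < p := by rw [sq]; exact_mod_cast hk
  have hd : (p : ℤ) ∣ x ^ 2 + x * y + y ^ 2 := by
    rw [← ZMod.intCast_zmod_eq_zero_iff_dvd]
    have hxy : (x : ZMod p) = r * y := by
      rw [hx, hy]; push_cast; linear_combination heq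
    push_cast
    rw [hxy]
    linear_combination (y : ZMod p) ^ 2 * hr
  have hpos : 0 < x ^ 2 + x * y + y ^ 2 := by
    rcases eq_or_ne y 0 with h0 | h0
    · have : x ≠ 0 := by
        rintro rfl
        exact hne (by ext <;> simp <;> omega)
      subst h0
      have := sq_pos_of_ne_zero this
      linarith
    · have := sq_pos_of_ne_zero h0
      nlinarith [sq_nonneg (2 * x + y)]
  obtain ⟨t, ht⟩ := hd
  have hp0 : (0 : ℤ) < p := by exact_mod_cast hp.pos
  have ht0 : 0 < t := by
    rw [ht] at hpos
    exact pos_of_mul_pos_right hpos hp0.le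
  have ht3 : t < 3 := by
    by_contra! h
    nlinarith [sq_nonneg (x - y)]
  interval_cases t
  · exact ⟨x, y, by linarith⟩
  · obtain ⟨q, hq⟩ : ∃ q : ℤ, (p : ℤ) = 2 * q + 1 := ⟨p / 2, by omega⟩
    exfalso
    rw [hq] at ht
    rcases Int.even_or_odd' x with ⟨i, hi | hi⟩ <;> rcases Int.even_or_odd' y with ⟨j, hj | hj⟩ <;>
      subst hi <;> subst hj <;> ring_nf at ht <;> omega

theorem exists_nontrivial_eisenstein_eq_sq {p a : ℕ} (hp : p.Prime) (hp6 : p % 6 = 1)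
    (ha : 0 < a) (hpa : p ∣ a) :
    ∃ u v : ℤ, u ^ 2 + u * v + v ^ 2 = (a : ℤ) ^ 2 ∧ u ≠ 0 ∧ v ≠ 0 ∧ u + v ≠ 0 := by
  obtain ⟨x, y, hxy⟩ := exists_eisenstein_eq_prime hp hp6
  obtain ⟨k, rfl⟩ := hpa
  have hk : (k : ℤ) ≠ 0 := by
    rintro h
    simp_all
  have hpi : Prime (p : ℤ) := Nat.prime_iff_prime_int.1 hp
  have hsq : ∀ z : ℤ, z ^ 2 ≠ p := fun z h => by
    rw [← h] at hpi
    exact not_prime_pow (by norm_num) hpi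
  have hsq3 : ∀ z : ℤ, 3 * z ^ 2 ≠ p := fun z h => by omega
  have hx : x ≠ 0 := by rintro rfl; exact hsq y (by linarith)
  have hy : y ≠ 0 := by rintro rfl; exact hsq x (by linarith)
  refine ⟨k * (x ^ 2 - y ^ 2), k * (y * (2 * x + y)), ?_, mul_ne_zero hk fun h => ?_,
    mul_ne_zero hk (mul_ne_zero hy fun h => ?_), fun h => ?_⟩
  · push_cast
    rw [← hxy]
    ring
  · rcases mul_eq_zero.1 (show (x - y) * (x + y) = 0 by linear_combination h) with h | h
    · obtain rfl : x = y := by linarith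
      exact hsq3 x (by linarith)
    · obtain rfl : x = -y := by linarith
      exact hsq y (by linarith)
  · obtain rfl : y = -2 * x := by linarith
    exact hsq3 x (by linarith)
  · have h' : k * x * (x + 2 * y) = 0 := by linear_combination h
    have : x = -2 * y := by
      have := (mul_eq_zero.1 h').resolve_left (mul_ne_zero hk hx)
      linarith
    subst this
    exact hsq3 y (by linarith)

/-- The Hermitian adjacency matrix of the directed triangle is `I` times this integer array;
the fourth index stands for an isolated vertex. -/
def cyc : Fin 4 → Fin 4 → ℤ :=
  ![![0, 1, -1, 0], ![-1, 0, 1, 0], ![1, -1, 0, 0], ![0, 0, 0, 0]]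

/-- The part of `C₃(x,y,z)` containing a given vertex. -/
def part (x y z : ℕ) : Fin x ⊕ Fin y ⊕ Fin z → Fin 4
  | Sum.inl _ => 0
  | Sum.inr (Sum.inl _) => 1
  | Sum.inr (Sum.inr _) => 2

theorem C3M_apply (x y z : ℕ) (u v : Fin x ⊕ Fin y ⊕ Fin z) :
    C3M x y z u v = I * cyc (part x y z u) (part x y z v) := by
  rcases u with u | u | u <;> rcases v with v | v | v <;> simp [C3M, cyc, part]

theorem card_part (x y z : ℕ) (i : Fin 4) :
    Fintype.card {v // part x y z v = i} = ![x, y, z, 0] i := by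
  rw [Fintype.card_subtype, Finset.card_filter, Fintype.sum_sum_type, Fintype.sum_sum_type]
  fin_cases i <;> simp [part]

theorem isHermAdj_C3M (x y z : ℕ) : IsHermAdj (C3M x y z) := by
  refine ⟨?_, ?_, ?_⟩
  · ext u v
    rcases u with u | u | u <;> rcases v with v | v | v <;> simp [C3M]
  · intro v
    rcases v with v | v | v <;> simp [C3M]
  · intro u v
    rcases u with u | u | u <;> rcases v with v | v | v <;> simp [C3M]

theorem IsHermAdj.pow_four {V : Type*} [Fintype V] {H : Matrix V V ℂ} (hH : IsHermAdj H) {u v : V}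
    (h : H u v ≠ 0) : H u v ^ 4 = 1 := by
  rcases hH.2.2 u v with h' | h' | h' | h'
  · exact absurd h' h
  · rw [h', one_pow]
  · rw [h', I_pow_four]
  · rw [h', neg_pow, I_pow_four]; norm_num

theorem IsHermAdj.mul_conj {V : Type*} [Fintype V] {H : Matrix V V ℂ} (hH : IsHermAdj H) {u v : V}
    (h : H u v ≠ 0) : H u v * (starRingEnd ℂ) (H u v) = 1 := by
  rcases hH.2.2 u v with h' | h' | h' | h'
  · exact absurd h' h
  all_goals rw [h']; simp

theorem mem_of_pow_four_eq_one {z : ℂ} (h : z ^ 4 = 1) :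
    z ∈ ({1, -1, I, -I} : Set ℂ) := by
  have : (z - 1) * ((z + 1) * ((z - I) * (z + I))) = 0 := by
    linear_combination h + (1 - z ^ 2) * I_sq
  simp only [mul_eq_zero, sub_eq_zero, add_eq_zero_iff_eq_neg] at this
  simpa using this

/-- If the rank is at most two, the whole matrix is determined by the two columns of an edge. -/
theorem IsHermAdj.apply_of_rank_le_two {V : Type*} [Fintype V] [DecidableEq V] {H : Matrix V V ℂ}
    (hH : IsHermAdj H) (hr : H.rank ≤ 2) {u v : V} (huv : H u v ≠ 0) (w x : V) :
    H w x = H u v * H w u * (starRingEnd ℂ) (H x v) +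
      (starRingEnd ℂ) (H u v) * H w v * (starRingEnd ℂ) (H x u) := by
  have hdet : (H.submatrix ![u, v, w] ![u, v, x]).det = 0 := by
    by_contra hdet
    have h1 := Matrix.rank_of_isUnit _ ((Matrix.isUnit_iff_isUnit_det _).2 (Ne.isUnit hdet))
    have h2 := Matrix.rank_submatrix_le H ![u, v, w] ![u, v, x]
    simp only [Fintype.card_fin] at h1
    omega
  have hu := hH.2.1 u
  have hv := hH.2.1 v
  have hc := hH.mul_conj huv
  have hs : ∀ i j, (starRingEnd ℂ) (H i j) = H j i := fun i j => hH.1.apply j i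
  rw [hs] at hc
  rw [Matrix.det_fin_three] at hdet
  simp [hu, hv] at hdet
  simp only [hs]
  linear_combination -hdet - H w x * hc

theorem IsHermAdj.exists_coloring_aux {V : Type*} [Fintype V] [DecidableEq V] {H : Matrix V V ℂ}
    (hH : IsHermAdj H) (hr : H.rank ≤ 2) {u v : V} (huv : H u v ≠ 0)
    (hτ : ∀ w, H w u ≠ 0 → H w v ≠ 0 → H u v * H w u * (starRingEnd ℂ) (H w v) = -I) :
    ∃ c : V → Fin 4, ∃ s : V → ℂ, (∀ w, s w ^ 4 = 1) ∧
      ∀ w x, H w x = s w * (starRingEnd ℂ) (s x) * (I * cyc (c w) (c x)) := by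
  have key : ∀ w, ∃ c : Fin 4, ∃ s : ℂ, s ^ 4 = 1 ∧
      ((c = 0 ∧ H w u = 0 ∧ s = (starRingEnd ℂ) (H u v) * H w v) ∨
       (c = 1 ∧ H w v = 0 ∧ s = I * H w u) ∨
       (c = 2 ∧ H w u = -I * (starRingEnd ℂ) (H u v) * H w v ∧
          s = -(starRingEnd ℂ) (H u v) * H w v) ∨
       (c = 3 ∧ H w u = 0 ∧ H w v = 0)) := by
    intro w
    have hb : (starRingEnd ℂ) (H u v) ^ 4 = 1 := by
      rw [← map_pow, hH.pow_four huv, map_one]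
    by_cases h1 : H w u = 0 <;> by_cases h2 : H w v = 0
    · exact ⟨3, 1, one_pow _, by simp [h1, h2]⟩
    · refine ⟨0, _, ?_, Or.inl ⟨rfl, h1, rfl⟩⟩
      rw [mul_pow, hb, hH.pow_four h2, one_mul]
    · refine ⟨1, _, ?_, Or.inr (Or.inl ⟨rfl, h2, rfl⟩)⟩
      rw [mul_pow, I_pow_four, hH.pow_four h1, one_mul]
    · refine ⟨2, _, ?_, Or.inr (Or.inr (Or.inl ⟨rfl, ?_, rfl⟩))⟩
      · rw [neg_mul, neg_pow, mul_pow, hb, hH.pow_four h2]; norm_num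
      · have e1 := hτ w h1 h2
        have e2 := hH.mul_conj huv
        have e3 := hH.mul_conj h2
        linear_combination (starRingEnd ℂ) (H u v) * H w v * e1 - H w u * e2 -
          H w u * H u v * (starRingEnd ℂ) (H u v) * e3
  choose c s hs4 hcs using key
  refine ⟨c, s, hs4, fun w x => ?_⟩
  rw [hH.apply_of_rank_le_two hr huv w x]
  have e := hH.mul_conj huv
  rcases hcs w with ⟨h1, h2, h3⟩ | ⟨h1, h2, h3⟩ | ⟨h1, h2, h3⟩ | ⟨h1, h2, h3⟩ <;>
  rcases hcs x with ⟨k1, k2, k3⟩ | ⟨k1, k2, k3⟩ | ⟨k1, k2, k3⟩ | ⟨k1, k2, k3⟩ <;>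
  simp [h1, h2, h3, k1, k2, k3, cyc]
  all_goals ring_nf
  all_goals simp only [I_sq]
  all_goals ring

/-- A Hermitian adjacency matrix of rank at most two is switching equivalent to the disjoint union
of some `C₃(x,y,z)`, with empty parts allowed, and isolated vertices. -/
theorem IsHermAdj.exists_coloring {V : Type*} [Fintype V] [DecidableEq V] {H : Matrix V V ℂ}
    (hH : IsHermAdj H) (hr : H.rank ≤ 2) :
    ∃ c : V → Fin 4, ∃ s : V → ℂ, (∀ w, s w ^ 4 = 1) ∧
      ∀ w x, H w x = s w * (starRingEnd ℂ) (s x) * (I * cyc (c w) (c x)) := by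
  by_cases h0 : ∀ u v, H u v = 0
  · exact ⟨fun _ => 3, fun _ => 1, by simp, by simp [h0, cyc]⟩
  push Not at h0
  obtain ⟨u, v, huv⟩ := h0
  set τ : V → ℂ := fun w => H u v * H w u * (starRingEnd ℂ) (H w v) with hτ
  have hs : ∀ i j, (starRingEnd ℂ) (H i j) = H j i := fun i j => hH.1.apply j i
  have hvu : H v u ≠ 0 := by rw [← hs]; simpa using huv
  have h4 : ∀ w, H w u ≠ 0 → H w v ≠ 0 → τ w = I ∨ τ w = -I := by
    intro w h1 h2
    have e1 : τ w ^ 4 = 1 := by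
      rw [hτ, mul_pow, mul_pow, ← map_pow, hH.pow_four huv, hH.pow_four h1, hH.pow_four h2]
      simp
    have e2 : τ w + (starRingEnd ℂ) (τ w) = 0 := by
      have := hH.apply_of_rank_le_two hr huv w w
      rw [hH.2.1 w] at this
      simp only [hτ, map_mul, conj_conj]
      linear_combination -this
    rcases mem_of_pow_four_eq_one e1 with h | h | h | h
    · rw [h] at e2; norm_num at e2
    · rw [h] at e2; norm_num at e2
    · exact Or.inl h
    · exact Or.inr h
  have hconst : ∀ w x, H w u ≠ 0 → H w v ≠ 0 → H x u ≠ 0 → H x v ≠ 0 →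
      τ w = I → τ x = -I → False := by
    intro w x w1 w2 x1 x2 hw hx
    have e := hH.apply_of_rank_le_two hr huv w x
    have ew := hH.mul_conj w2
    have ex := hH.mul_conj x2
    have e1 : H w x = 2 * I * H w v * (starRingEnd ℂ) (H x v) := by
      have f1 : H u v * H w u = I * H w v := by
        linear_combination H w v * hw - H u v * H w u * ew
      have f2 : H u v * H x u = -I * H x v := by
        linear_combination H x v * hx - H u v * H x u * ex
      have f3 := congrArg (starRingEnd ℂ) f2
      simp only [map_mul, map_neg, conj_I] at f3
      rw [e]
      linear_combination (starRingEnd ℂ) (H x v) * f1 + H w v * f3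
    have e2 : H w x ^ 4 = 16 := by
      rw [e1, mul_pow, mul_pow, mul_pow, ← map_pow, hH.pow_four w2, hH.pow_four x2, I_pow_four]
      norm_num
    have e3 : H w x ≠ 0 := by
      intro h; rw [h] at e2; norm_num at e2
    rw [hH.pow_four e3] at e2
    norm_num at e2
  by_cases hall : ∀ w, H w u ≠ 0 → H w v ≠ 0 → τ w = -I
  · exact hH.exists_coloring_aux hr huv hall
  · push Not at hall
    obtain ⟨w, w1, w2, hw⟩ := hall
    have hw' := (h4 w w1 w2).resolve_right hw
    refine hH.exists_coloring_aux hr hvu fun x x1 x2 => ?_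
    have := (h4 x x2 x1).resolve_right fun h => hconst w x w1 w2 x2 x1 hw' h
    rw [← conj_I, ← this, hτ]
    simp only [map_mul, conj_conj, hs u v]
    ring

theorem Matrix.IsHermitian.rank_eq_of_charpoly_eq {V : Type*} [Fintype V] [DecidableEq V]
    {A B : Matrix V V ℂ} (hA : A.IsHermitian) (hB : B.IsHermitian) (h : A.charpoly = B.charpoly) :
    A.rank = B.rank := by
  simp only [hA.rank_eq_card_non_zero_eigs, hB.rank_eq_card_non_zero_eigs,
    (hA.eigenvalues_eq_eigenvalues_iff hB).2 h]

theorem rank_C3M_le (x y z : ℕ) : (C3M x y z).rank ≤ 2 := by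
  have h : C3M x y z =
      (Matrix.of fun v => ![![1, 0], ![0, 1], ![-1, -1], 0] (part x y z v) : Matrix _ (Fin 2) ℂ) *
      (Matrix.of ![fun v => I * ![0, 1, -1, 0] (part x y z v),
        fun v => I * ![-1, 0, 1, 0] (part x y z v)] : Matrix (Fin 2) _ ℂ) := by
    ext u v
    rcases u with u | u | u <;> rcases v with v | v | v <;>
      simp [C3M, part, Matrix.mul_apply, Fin.sum_univ_two]
  rw [h]
  exact (Matrix.rank_mul_le_left _ _).trans ((Matrix.rank_le_card_width _).trans (by simp))

open Polynomial in
theorem charpoly_coloring {V : Type*} [Fintype V] [DecidableEq V] {H : Matrix V V ℂ}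
    {c : V → Fin 4} {s : V → ℂ} (hs : ∀ w, s w ^ 4 = 1)
    (h : ∀ w x, H w x = s w * (starRingEnd ℂ) (s x) * (I * cyc (c w) (c x))) {N : Fin 4 → ℕ}
    (hN : ∀ i, Fintype.card {v // c v = i} = N i) :
    X ^ 4 * H.charpoly =
      X ^ Fintype.card V * (X ^ 2 * (X ^ 2 - C ((N 0 * N 1 + N 1 * N 2 + N 2 * N 0 : ℕ) : ℂ))) := by
  have hss : ∀ w, (starRingEnd ℂ) (s w) * s w = 1 := fun w => by
    rcases mem_of_pow_four_eq_one (hs w) with h | h | h | h <;> rw [h] <;> simp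
  let P : Matrix V (Fin 4) ℂ := Matrix.of fun v i => if c v = i then s v else 0
  let Q : Matrix (Fin 4) V ℂ := Matrix.of fun i v => (starRingEnd ℂ) (s v) * (I * cyc i (c v))
  have hPQ : H = P * Q := by
    ext u v
    simp [P, Q, Matrix.mul_apply, h, mul_assoc]
  have hQP : Q * P = Matrix.of fun i j => I * cyc i j * N j := by
    ext i j
    simp only [Matrix.mul_apply, P, Q, Matrix.of_apply, ← hN, Fintype.card_subtype,
      Finset.card_filter, Nat.cast_sum, Finset.mul_sum]
    refine Finset.sum_congr rfl fun v _ => ?_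
    split_ifs with hv
    · subst hv
      linear_combination (I * cyc i (c v)) * hss v
    · simp
  have := Matrix.charpoly_mul_comm' P Q
  rw [Fintype.card_fin, ← hPQ, hQP] at this
  rw [this]
  congr 1
  rw [Matrix.charpoly, Matrix.det_succ_row_zero]
  simp [Fin.sum_univ_succ, Matrix.det_fin_three, Matrix.charmatrix_apply, cyc, Fin.succAbove]
  have hI : (C I : ℂ[X]) ^ 2 = -1 := by rw [← C_pow, I_sq, C_neg, C_1]
  linear_combination (X ^ 2 * ((N 0 : ℂ[X]) * N 1 + N 1 * N 2 + N 2 * N 0)) * hI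

theorem charpoly_C3M (x y z : ℕ) : Polynomial.X ^ 4 * (C3M x y z).charpoly =
    Polynomial.X ^ (x + (y + z)) * (Polynomial.X ^ 2 *
      (Polynomial.X ^ 2 - Polynomial.C ((x * y + y * z + z * x : ℕ) : ℂ))) := by
  have := charpoly_coloring (H := C3M x y z) (c := part x y z) (s := fun _ => 1)
    (fun _ => one_pow _) (fun u v => by simp [C3M_apply]) (card_part x y z)
  simpa using this

theorem card_C3M_eq_zero (x y z : ℕ) (v : Fin x ⊕ Fin y ⊕ Fin z) :
    Fintype.card {w // C3M x y z v w = 0} = ![x, y, z, 0] (part x y z v) := by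
  rw [Fintype.card_subtype, Finset.card_filter, Fintype.sum_sum_type, Fintype.sum_sum_type]
  rcases v with v | v | v <;> simp [C3M, part]

theorem cyc_perm : ∀ π : Equiv.Perm (Fin 4), π 3 = 3 →
    (∀ i j, cyc (π i) (π j) = cyc i j) ∨ (∀ i j, cyc (π i) (π j) = -cyc i j) := by
  decide

theorem exists_perm_of_sizes (a n : ℕ) (ha : 0 < a) (han : a < n) (hsq : a ^ 2 < 2 * n)
    (hp : ¬ ∃ p : ℕ, p.Prime ∧ p % 6 = 1 ∧ p ∣ a) (N : Fin 4 → ℕ)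
    (hsum : N 0 + N 1 + N 2 + N 3 = 3 * n)
    (hmul : N 0 * N 1 + N 1 * N 2 + N 2 * N 0 = (n - a) * n + n * (n + a) + (n + a) * (n - a)) :
    ∃ π : Equiv.Perm (Fin 4), π 3 = 3 ∧ ∀ i, N i = ![n - a, n, n + a, 0] (π i) := by
  obtain ⟨b, rfl⟩ := Nat.exists_eq_add_of_lt han
  set n := a + b + 1 with hn
  have hna : n - a = b + 1 := by omega
  rw [hna] at hmul ⊢
  zify at hmul hsum hsq hn ha
  have h3 : N 3 = 0 := by
    by_contra h
    have h3 : (1 : ℤ) ≤ N 3 := by exact_mod_cast Nat.one_le_iff_ne_zero.2 h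
    have e1 : ((N 0 : ℤ) + N 1 + N 2) ^ 2 ≤ (3 * n - 1) ^ 2 := by
      apply pow_le_pow_left₀ (by positivity); linarith
    have hb : (b : ℤ) = n - a - 1 := by linarith
    rw [hb] at hmul
    nlinarith [sq_nonneg ((N 0 : ℤ) - N 1), sq_nonneg ((N 1 : ℤ) - N 2),
      sq_nonneg ((N 2 : ℤ) - N 0)]
  have hb : (b : ℤ) = n - a - 1 := by linarith
  have hN2 : (N 2 : ℤ) = 3 * n - N 0 - N 1 := by rw [h3] at hsum; push_cast at hsum; linarith
  have hq := mul_eq_zero_of_eisenstein_eq_sq a (by exact_mod_cast ha) hp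
    ((N 0 : ℤ) - n) ((N 1 : ℤ) - n) (by rw [hb, hN2] at hmul; linear_combination -hmul)
  have hab : ∀ t : ℤ, t ^ 2 = (a : ℤ) ^ 2 → t = a ∨ t = -a := fun t h =>
    sq_eq_sq_iff_eq_or_eq_neg.1 h
  rw [hb, hN2] at hmul
  have hcases : (N 0 = n ∧ N 1 = b + 1 ∧ N 2 = n + a) ∨ (N 0 = n ∧ N 1 = n + a ∧ N 2 = b + 1) ∨
      (N 1 = n ∧ N 0 = b + 1 ∧ N 2 = n + a) ∨ (N 1 = n ∧ N 0 = n + a ∧ N 2 = b + 1) ∨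
      (N 2 = n ∧ N 0 = b + 1 ∧ N 1 = n + a) ∨ (N 2 = n ∧ N 0 = n + a ∧ N 1 = b + 1) := by
    rcases mul_eq_zero.1 hq with h | h
    · rcases mul_eq_zero.1 h with h | h
      · have h' : (N 0 : ℤ) = n := by linarith
        rcases hab ((N 1 : ℤ) - n) (by rw [h'] at hmul; linear_combination -hmul) with h | h <;>
          omega
      · have h' : (N 1 : ℤ) = n := by linarith
        rcases hab ((N 0 : ℤ) - n) (by rw [h'] at hmul; linear_combination -hmul) with h | h <;>
          omega
    · have h' : (N 1 : ℤ) = 2 * n - N 0 := by linarith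
      rcases hab ((N 0 : ℤ) - n) (by rw [h'] at hmul; linear_combination -hmul) with h | h <;> omega
  rcases hcases with ⟨h0, h1, h2⟩ | ⟨h0, h1, h2⟩ | ⟨h0, h1, h2⟩ | ⟨h0, h1, h2⟩ | ⟨h0, h1, h2⟩ |
    ⟨h0, h1, h2⟩
  · refine ⟨Equiv.swap 0 1, by decide, fun i => ?_⟩
    fin_cases i <;> simp [Equiv.swap_apply_def, *]
  · refine ⟨Equiv.swap 0 1 * Equiv.swap 1 2, by decide, fun i => ?_⟩
    fin_cases i <;> simp [Equiv.swap_apply_def, *]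
  · refine ⟨1, by decide, fun i => ?_⟩
    fin_cases i <;> simp [*]
  · refine ⟨Equiv.swap 0 2, by decide, fun i => ?_⟩
    fin_cases i <;> simp [Equiv.swap_apply_def, *]
  · refine ⟨Equiv.swap 1 2, by decide, fun i => ?_⟩
    fin_cases i <;> simp [Equiv.swap_apply_def, *]
  · refine ⟨Equiv.swap 1 2 * Equiv.swap 0 1, by decide, fun i => ?_⟩
    fin_cases i <;> simp [Equiv.swap_apply_def, *]

theorem isDHS_C3M (a n : ℕ) (ha : 0 < a) (han : a < n) (hsq : a ^ 2 < 2 * n)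
    (hp : ¬ ∃ p : ℕ, p.Prime ∧ p % 6 = 1 ∧ p ∣ a) : IsDHS (C3M (n - a) n (n + a)) := by
  intro H hH hchar
  have hr : H.rank ≤ 2 := by
    rw [hH.1.rank_eq_of_charpoly_eq (isHermAdj_C3M _ _ _).1 hchar]
    exact rank_C3M_le _ _ _
  obtain ⟨c, s, hs, hc⟩ := hH.exists_coloring hr
  obtain ⟨N, hN⟩ : ∃ N : Fin 4 → ℕ, ∀ i, Fintype.card {v // c v = i} = N i := ⟨_, fun _ => rfl⟩
  have hsum : N 0 + N 1 + N 2 + N 3 = 3 * n := by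
    have := Fintype.card_congr (Equiv.sigmaFiberEquiv c)
    rw [Fintype.card_sigma, Fin.sum_univ_four] at this
    simp only [hN, Fintype.card_sum, Fintype.card_fin] at this
    omega
  have hmul : N 0 * N 1 + N 1 * N 2 + N 2 * N 0 =
      (n - a) * n + n * (n + a) + (n + a) * (n - a) := by
    have h1 := charpoly_coloring hs hc hN
    rw [hchar, charpoly_C3M] at h1
    simp only [Fintype.card_sum, Fintype.card_fin] at h1
    have h2 := mul_left_cancel₀ (pow_ne_zero _ Polynomial.X_ne_zero)
      (mul_left_cancel₀ (pow_ne_zero _ Polynomial.X_ne_zero) h1)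
    exact_mod_cast (Polynomial.C_injective (sub_right_injective h2)).symm
  obtain ⟨π, hπ3, hπ⟩ := exists_perm_of_sizes a n ha han hsq hp N hsum hmul
  have hfib : ∀ j, Nonempty ({v // π (c v) = j} ≃ {v // part (n - a) n (n + a) v = j}) := by
    intro j
    rw [← Fintype.card_eq, card_part]
    simp only [← Equiv.eq_symm_apply, hN, hπ, Equiv.apply_symm_apply]
  have e := fun j => (hfib j).some
  let σ : Equiv.Perm (Fin (n - a) ⊕ Fin n ⊕ Fin (n + a)) :=
    Equiv.ofFiberEquiv (f := fun v => π (c v)) (g := part (n - a) n (n + a)) e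
  have hσ : ∀ v, part (n - a) n (n + a) (σ v) = π (c v) := fun v => Equiv.ofFiberEquiv_map e v
  refine ⟨σ, s, fun v => mem_of_pow_four_eq_one (hs v), ?_⟩
  refine (cyc_perm π hπ3).imp (fun h u v => ?_) fun h u v => ?_
  · rw [C3M_apply, hσ, hσ, h, hc]
  · rw [C3M_apply, hσ, hσ, h, hc]
    simp

theorem not_isDHS_C3M (a n : ℕ) (ha : 0 < a) (han : a < n) (hsq : a ^ 2 < 2 * n) {p : ℕ}
    (hp : p.Prime) (hp6 : p % 6 = 1) (hpa : p ∣ a) : ¬ IsDHS (C3M (n - a) n (n + a)) := by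
  intro hD
  obtain ⟨u, v, huv, hu, hv, hw⟩ := exists_nontrivial_eisenstein_eq_sq hp hp6 ha hpa
  have ha7 : 7 ≤ a := by
    have := hp.two_le
    have := Nat.le_of_dvd ha hpa
    omega
  have hn : (25 : ℤ) ≤ n := by
    have : 25 ≤ n := by nlinarith
    exact_mod_cast this
  have hsq' : (a : ℤ) ^ 2 < 2 * n := by exact_mod_cast hsq
  have hbound : ∀ t r : ℤ, t ^ 2 + t * r + r ^ 2 = (a : ℤ) ^ 2 → 0 < n + t := by
    intro t r h
    have : |t| < |(n : ℤ)| := sq_lt_sq.1 (by nlinarith [sq_nonneg (t + 2 * r)])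
    rw [Nat.abs_cast] at this
    linarith [(abs_lt.1 this).1]
  obtain ⟨x, hx⟩ := Int.eq_ofNat_of_zero_le (hbound u v huv).le
  obtain ⟨y, hy⟩ := Int.eq_ofNat_of_zero_le (hbound v u (by linarith)).le
  obtain ⟨z, hz⟩ := Int.eq_ofNat_of_zero_le (hbound (-u - v) u (by linarith)).le
  have hx0 : 0 < x := by have := hbound u v huv; omega
  have hcard : (n - a) + (n + (n + a)) = x + (y + z) := by omega
  have hmul : (n - a) * n + n * (n + a) + (n + a) * (n - a) = x * y + y * z + z * x := by
    zify [han.le]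
    rw [← hx, ← hy, ← hz]
    linear_combination huv
  let e : Fin (n - a) ⊕ Fin n ⊕ Fin (n + a) ≃ Fin x ⊕ Fin y ⊕ Fin z :=
    Fintype.equivOfCardEq (by simpa using hcard)
  have hA := isHermAdj_C3M x y z
  obtain ⟨σ, s, hs, h⟩ := hD ((C3M x y z).submatrix e e)
    ⟨hA.1.submatrix e, fun v => hA.2.1 _, fun u v => hA.2.2 _ _⟩ (by
      have h1 := Matrix.charpoly_reindex e.symm (C3M x y z)
      rw [Matrix.reindex_apply, Equiv.symm_symm] at h1
      rw [h1]
      apply mul_left_cancel₀ (pow_ne_zero 4 Polynomial.X_ne_zero)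
      rw [charpoly_C3M, charpoly_C3M, hcard, hmul])
  have hs0 : ∀ v, s v ≠ 0 := fun v => by
    rcases hs v with h | h | h | h <;> rw [h] <;> simp
  have hz0 : ∀ i j, C3M x y z (e i) (e j) = 0 ↔ C3M (n - a) n (n + a) (σ i) (σ j) = 0 := by
    intro i j
    change (C3M x y z).submatrix e e i j = 0 ↔ _
    rcases h with h | h <;> rw [h] <;> simp [hs0]
  obtain ⟨i, hi⟩ := e.surjective (Sum.inl ⟨0, hx0⟩)
  have hcount : x = ![n - a, n, n + a, 0] (part _ _ _ (σ i)) := by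
    rw [← card_C3M_eq_zero]
    calc x = Fintype.card {w // C3M x y z (e i) w = 0} := by
          rw [card_C3M_eq_zero, hi]; rfl
      _ = Fintype.card {w // C3M (n - a) n (n + a) (σ i) w = 0} :=
          Fintype.card_congr ((e.subtypeEquiv fun j => (hz0 i j).symm).symm.trans
            (σ.subtypeEquiv fun j => Iff.rfl))
  have hu3 : u = -a ∨ u = a := by
    rcases hσ : σ i with k | k | k <;> rw [hσ] at hcount <;> simp [part] at hcount <;> omega
  have : v * (u + v) = 0 := by
    rcases hu3 with rfl | rfl <;> linear_combination huv
  exact mul_ne_zero hv hw this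

theorem stmt16 (a n : ℕ) (ha : 0 < a) (han : a < n) (hsq : a ^ 2 < 2 * n) :
    IsDHS (C3M (n - a) n (n + a)) ↔
      ¬ ∃ p : ℕ, p.Prime ∧ p % 6 = 1 ∧ p ∣ a :=
  ⟨fun h ⟨_, hp, hp6, hpa⟩ => not_isDHS_C3M a n ha han hsq hp hp6 hpa h,
    isDHS_C3M a n ha han hsq⟩
end
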